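/- Fix c > 1. Let f̃ be the infinite product of Bernoulli(1/2) measures on Ω^∞ (the fair-coin measure) and let g̃ be the point mass at the all-ones sequence 1̄ = (1,1,1,…). Define the test T by: T_{t+1}(ω,f,g) = 1/(1 + c·g̃([ω^t])/f̃([ω^t])) if (f,g) = (f̃,g̃) and ω agrees with 1̄ in its first t coordinates; T_{t+1}(ω,f,g) = 1 − 1/(1 + c·g̃([ω^t])/f̃([ω^t])) if (f,g) = (g̃,f̃) and ω agrees with 1̄ in its first t coordinates; and T_{t+1}(ω,f,g) = D_{t+1}(ω,f,g) in all other cases. Then T is an anonymous, error-free and reasonable cardinal comparison test (which differs from D). -/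

import Mathlib

open MeasureTheory Filter Set
open scoped ENNReal

/-- The space Ω^∞ of infinite binary sequences. -/
abbrev BinSeq : Type := ℕ → Bool

/-- The cylinder set `[ω^t]` of sequences agreeing with `ω` in the first `t` coordinates. -/
def cyl (ω : BinSeq) (t : ℕ) : Set BinSeq := {ω' | ∀ i < t, ω' i = ω i}

/-- A (candidate) cardinal comparison test: to each ordered pair of measures, each time `t`
and each realization `ω` it assigns a number. -/
abbrev Test : Type := Measure BinSeq → Measure BinSeq → ℕ → BinSeq → ℝ

/-- The σ-algebra on `BinSeq` generated by the first `t` coordinates. -/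
def coordAlg (t : ℕ) : MeasurableSpace BinSeq :=
  MeasurableSpace.comap (fun ω (i : Fin t) => ω (i : ℕ)) inferInstance

/-- A cardinal comparison test: values in `[0,1]`, and `T_t` is measurable with respect to the
σ-algebra generated by the first `t` coordinates, for every `t ≥ 1`. -/
def IsCCTest (T : Test) : Prop :=
  ∀ f g : Measure BinSeq, IsProbabilityMeasure f → IsProbabilityMeasure g →
    ∀ t : ℕ, 1 ≤ t →
      (∀ ω, T f g t ω ∈ Set.Icc (0:ℝ) 1) ∧ @Measurable BinSeq ℝ (coordAlg t) _ (T f g t)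

/-- `L_{T,ε}^{(f,g)}`: the set of `ω` where `lim_t T_t(ω,f,g)` exists and is `> ε`. -/
def LSet (T : Test) (f g : Measure BinSeq) (ε : ℝ) : Set BinSeq :=
  {ω | ∃ l : ℝ, Tendsto (fun t => T f g t ω) atTop (nhds l) ∧ ε < l}

/-- `R_{T,ε}^{(f,g)}`: the set of `ω` where `lim_t T_t(ω,f,g)` exists and is `< ε`. -/
def RSet (T : Test) (f g : Measure BinSeq) (ε : ℝ) : Set BinSeq :=
  {ω | ∃ l : ℝ, Tendsto (fun t => T f g t ω) atTop (nhds l) ∧ l < ε}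

/-- Anonymity: `T_t(ω,f,g) = 1 - T_t(ω,g,f)`. -/
def Anonymous (T : Test) : Prop :=
  ∀ f g : Measure BinSeq, IsProbabilityMeasure f → IsProbabilityMeasure g →
    ∀ t : ℕ, 1 ≤ t → ∀ ω, T f g t ω = 1 - T g f t ω

/-- Error-freeness. -/
def ErrorFree (T : Test) : Prop :=
  ∀ f g : Measure BinSeq, IsProbabilityMeasure f → IsProbabilityMeasure g →
    ∀ A : Set BinSeq, MeasurableSet A →
      (∀ ε : ℝ, ε ∈ Set.Ioo 0 (1/2) →
        f (A ∩ RSet T f g ε) ≤ ENNReal.ofReal (ε / (1 - ε)) * g (A ∩ RSet T f g ε)) ∧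
      (∀ ε : ℝ, ε ∈ Set.Ioo (1/2) 1 →
        g (A ∩ LSet T f g ε) ≤ ENNReal.ofReal ((1 - ε) / ε) * f (A ∩ LSet T f g ε))

/-- Reasonableness. -/
def Reasonable (T : Test) : Prop :=
  ∀ f g : Measure BinSeq, IsProbabilityMeasure f → IsProbabilityMeasure g →
    ∀ A : Set BinSeq, MeasurableSet A →
      (∀ ε : ℝ, ε ∈ Set.Ioo 0 (1/2) →
        0 < g A → f A < ENNReal.ofReal (ε / (1 - ε)) * g A →
          0 < g (A ∩ RSet T f g ε)) ∧
      (∀ ε : ℝ, ε ∈ Set.Ioo (1/2) 1 →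
        0 < f A → g A < ENNReal.ofReal ((1 - ε) / ε) * f A →
          0 < f (A ∩ LSet T f g ε))

/-- The finite derivative test `D`. -/
noncomputable def Dtest : Test := fun f g t ω =>
  match t with
  | 0 => 1/2
  | Nat.succ s =>
      if 0 < f (cyl ω s) + g (cyl ω s) then
        (f (cyl ω s)).toReal / ((f (cyl ω s)).toReal + (g (cyl ω s)).toReal)
      else 1/2


/-- The all-ones sequence. -/
def ones : BinSeq := fun _ => true

/-- The restriction of a sequence to its first `s` coordinates. -/
def initial (s : ℕ) (ω : BinSeq) (i : Fin s) : Bool := ω i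

lemma measurable_initial (s : ℕ) : Measurable (initial s) :=
  measurable_pi_lambda _ fun i => measurable_pi_apply (i : ℕ)

lemma mem_cyl_iff_initial_eq {ω ω' : BinSeq} {s : ℕ} :
    ω' ∈ cyl ω s ↔ initial s ω' = initial s ω :=
  ⟨fun h => funext fun i => h i i.2, fun h i hi => congrFun h ⟨i, hi⟩⟩

lemma cyl_eq_preimage (ω : BinSeq) (s : ℕ) : cyl ω s = initial s ⁻¹' {initial s ω} := by
  ext ω'
  simp [mem_cyl_iff_initial_eq]

lemma mem_cyl_self (ω : BinSeq) (s : ℕ) : ω ∈ cyl ω s := fun _ _ => rfl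

lemma cyl_eq_of_mem {ω ω' : BinSeq} {s : ℕ} (h : ω' ∈ cyl ω s) : cyl ω' s = cyl ω s := by
  rw [cyl_eq_preimage, cyl_eq_preimage, mem_cyl_iff_initial_eq.1 h]

lemma mem_cyl_comm {ω ω' : BinSeq} {s : ℕ} : ω' ∈ cyl ω s ↔ ω ∈ cyl ω' s := by
  rw [mem_cyl_iff_initial_eq, mem_cyl_iff_initial_eq, eq_comm]

lemma initial_surjective (s : ℕ) : Function.Surjective (initial s) := fun b =>
  ⟨fun i => if h : i < s then b ⟨i, h⟩ else true, by ext i; simp [initial]⟩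

lemma coordAlg_mono : Monotone coordAlg := by
  intro s t hst
  rintro _ ⟨B, hB, rfl⟩
  refine ⟨(fun (b : Fin t → Bool) (i : Fin s) => b (Fin.castLE hst i)) ⁻¹' B,
    Set.Finite.measurableSet (Set.toFinite _), rfl⟩

lemma coordAlg_le (s : ℕ) : coordAlg s ≤ (inferInstance : MeasurableSpace BinSeq) :=
  (measurable_initial s).comap_le

lemma iSup_coordAlg : ⨆ s, coordAlg s = (inferInstance : MeasurableSpace BinSeq) := by
  refine le_antisymm (iSup_le coordAlg_le) (iSup_le fun i => ?_)
  refine le_trans ?_ (le_iSup coordAlg (i + 1))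
  rintro _ ⟨B, -, rfl⟩
  exact ⟨(fun b : Fin (i + 1) → Bool => b (Fin.last i)) ⁻¹' B,
    Set.Finite.measurableSet (Set.toFinite _), rfl⟩

/-- The filtration generated by the coordinates. -/
def coordFiltration : Filtration ℕ (inferInstance : MeasurableSpace BinSeq) where
  seq := coordAlg
  mono' := coordAlg_mono
  le' := coordAlg_le

lemma measurable_coordAlg_of_cyl {F : BinSeq → ℝ} {s : ℕ}
    (h : ∀ ω, ∀ ω' ∈ cyl ω s, F ω' = F ω) : Measurable[coordAlg s] F := by
  intro S _
  refine ⟨initial s '' (F ⁻¹' S), Set.Finite.measurableSet (Set.toFinite _), ?_⟩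
  ext ω
  constructor
  · rintro ⟨ω', hω', he⟩
    have : F ω' = F ω := h ω ω' (mem_cyl_iff_initial_eq.2 he)
    simpa [← this] using hω'
  · exact fun hω => ⟨ω, hω, rfl⟩

lemma Dtest_eq_of_mem_cyl (f g : Measure BinSeq) {s : ℕ} {ω ω' : BinSeq} (h : ω' ∈ cyl ω s) :
    Dtest f g (s + 1) ω' = Dtest f g (s + 1) ω := by
  simp only [Dtest, cyl_eq_of_mem h]

lemma Dtest_mem_Icc (f g : Measure BinSeq) (s : ℕ) (ω : BinSeq) :
    Dtest f g (s + 1) ω ∈ Set.Icc (0 : ℝ) 1 := by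
  simp only [Dtest]
  split_ifs
  · exact ⟨by positivity, div_le_one_of_le₀ (by simp) (by positivity)⟩
  · norm_num

section FiniteMeasures

variable (f g : Measure BinSeq) [IsFiniteMeasure f] [IsFiniteMeasure g]

lemma Dtest_swap (s : ℕ) (ω : BinSeq) :
    Dtest f g (s + 1) ω = 1 - Dtest g f (s + 1) ω := by
  simp only [Dtest, add_comm (g _)]
  split_ifs with h
  · have h' : (0 : ℝ) < (f (cyl ω s)).toReal + (g (cyl ω s)).toReal := by
      rw [← ENNReal.toReal_add (by simp) (by simp)]
      exact ENNReal.toReal_pos h.ne' (by simp)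
    rw [add_comm (g _).toReal]
    field_simp
    ring
  · norm_num

lemma real_cyl_mul_Dtest (s : ℕ) (ω : BinSeq) :
    (f + g).real (cyl ω s) * Dtest f g (s + 1) ω = f.real (cyl ω s) := by
  simp only [Dtest, measureReal_def, Measure.coe_add, Pi.add_apply]
  rw [ENNReal.toReal_add (by simp) (by simp)]
  split_ifs with h
  · have h' : (0 : ℝ) < (f (cyl ω s)).toReal + (g (cyl ω s)).toReal := by
      rw [← ENNReal.toReal_add (by simp) (by simp)]
      exact ENNReal.toReal_pos h.ne' (by simp)
    field_simp
  · simp only [not_lt, nonpos_iff_eq_zero, add_eq_zero] at h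
    simp [h.1, h.2]

lemma setIntegral_Dtest {s : ℕ} {S : Set BinSeq} (hS : MeasurableSet[coordAlg s] S) :
    ∫ ω in S, Dtest f g (s + 1) ω ∂(f + g) = f.real S := by
  classical
  obtain ⟨B, -, rfl⟩ := hS
  change ∫ ω in initial s ⁻¹' B, Dtest f g (s + 1) ω ∂(f + g) = f.real (initial s ⁻¹' B)
  obtain ⟨e, he⟩ := (initial_surjective s).hasRightInverse
  have hB : MeasurableSet B := Set.Finite.measurableSet (Set.toFinite _)
  have hD : ∀ ω, Dtest f g (s + 1) ω = Dtest f g (s + 1) (e (initial s ω)) := fun ω =>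
    Dtest_eq_of_mem_cyl f g (mem_cyl_iff_initial_eq.2 (he _).symm)
  have hm : Measurable fun b => Dtest f g (s + 1) (e b) := measurable_of_finite _
  rw [funext hD, ← setIntegral_map (f := fun b => Dtest f g (s + 1) (e b)) hB
    hm.aestronglyMeasurable (measurable_initial s).aemeasurable,
    ← map_measureReal_apply (measurable_initial s) hB, ← Set.coe_toFinset B,
    setIntegral_finset _ Integrable.of_finite, ← sum_measureReal_singleton]
  refine Finset.sum_congr rfl fun b _ => ?_
  rw [map_measureReal_apply (measurable_initial s) (measurableSet_singleton b),
    map_measureReal_apply (measurable_initial s) (measurableSet_singleton b), smul_eq_mul]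
  have hb := real_cyl_mul_Dtest f g s (e b)
  rwa [cyl_eq_preimage, he b] at hb

lemma Dtest_ae_eq_condExp (s : ℕ) :
    Dtest f g (s + 1) =ᵐ[f + g]
      (f + g)[fun ω => (f.rnDeriv (f + g) ω).toReal | coordAlg s] := by
  have hmeas : Measurable[coordAlg s] (Dtest f g (s + 1)) :=
    measurable_coordAlg_of_cyl fun _ _ h => Dtest_eq_of_mem_cyl f g h
  have hac : f ≪ f + g := Measure.absolutelyContinuous_of_le (Measure.le_add_right le_rfl)
  refine ae_eq_condExp_of_forall_setIntegral_eq (coordAlg_le s)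
    Measure.integrable_toReal_rnDeriv (fun S _ _ => ?_) (fun S hS _ => ?_)
    hmeas.aestronglyMeasurable
  · refine (Integrable.of_bound (hmeas.mono (coordAlg_le s) le_rfl).aestronglyMeasurable 1
      (ae_of_all _ fun ω => ?_)).integrableOn
    rw [Real.norm_eq_abs, abs_of_nonneg (Dtest_mem_Icc f g s ω).1]
    exact (Dtest_mem_Icc f g s ω).2
  · rw [setIntegral_Dtest f g hS, Measure.setIntegral_toReal_rnDeriv hac]

lemma ae_tendsto_Dtest :
    ∀ᵐ ω ∂(f + g), Tendsto (fun t => Dtest f g t ω) atTop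
      (nhds (f.rnDeriv (f + g) ω).toReal) := by
  have hlim := tendsto_ae_condExp (ℱ := coordFiltration) (μ := f + g)
    (fun ω => (f.rnDeriv (f + g) ω).toReal)
  have hsup : ⨆ n, coordFiltration n = (inferInstance : MeasurableSpace BinSeq) := iSup_coordAlg
  rw [hsup, condExp_of_stronglyMeasurable le_rfl
    (Measure.measurable_rnDeriv _ _).ennreal_toReal.stronglyMeasurable
    Measure.integrable_toReal_rnDeriv] at hlim
  filter_upwards [hlim, ae_all_iff.2 (Dtest_ae_eq_condExp f g)] with ω h1 h2
  refine (tendsto_add_atTop_iff_nat 1).1 ?_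
  simp_rw [h2]
  exact h1

end FiniteMeasures

lemma ae_rnDeriv_add_eq_one {Ω : Type*} [MeasurableSpace Ω] (f g : Measure Ω)
    [IsFiniteMeasure f] [IsFiniteMeasure g] :
    ∀ᵐ ω ∂(f + g), f.rnDeriv (f + g) ω + g.rnDeriv (f + g) ω = 1 := by
  filter_upwards [Measure.rnDeriv_add f g (f + g), Measure.rnDeriv_self (f + g)] with ω h1 h2
  rw [← Pi.add_apply, ← h1, h2]

/-- If the densities are ordered on a set, then so are the measures of the set. -/
lemma measure_le_mul_of_ae_rnDeriv_le {Ω : Type*} [MeasurableSpace Ω]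
    {μ ν ρ : Measure Ω} [IsFiniteMeasure μ] [IsFiniteMeasure ν] [IsFiniteMeasure ρ]
    (hμ : μ ≪ ρ) (hν : ν ≪ ρ) {a b : ℝ≥0∞} {B : Set Ω}
    (h : ∀ᵐ ω ∂ρ, ω ∈ B → a * μ.rnDeriv ρ ω ≤ b * ν.rnDeriv ρ ω) :
    a * μ B ≤ b * ν B := by
  rw [← Measure.setLIntegral_rnDeriv hμ B, ← Measure.setLIntegral_rnDeriv hν B,
    ← lintegral_const_mul _ (Measure.measurable_rnDeriv _ _),
    ← lintegral_const_mul _ (Measure.measurable_rnDeriv _ _)]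
  exact setLIntegral_mono_ae ((Measure.measurable_rnDeriv _ _).const_mul _).aemeasurable h

lemma le_ofReal_div_mul_of_toReal_le {p q : ℝ≥0∞} (hpq : p + q = 1) {ε : ℝ} (hε : ε < 1)
    (hp : p.toReal ≤ ε) : p ≤ ENNReal.ofReal (ε / (1 - ε)) * q := by
  have hp' : p ≠ ⊤ := ne_top_of_le_ne_top ENNReal.one_ne_top (hpq ▸ le_self_add)
  have hq' : q ≠ ⊤ := ne_top_of_le_ne_top ENNReal.one_ne_top (hpq ▸ le_add_self)
  have hsum : p.toReal + q.toReal = 1 := by rw [← ENNReal.toReal_add hp' hq', hpq]; rfl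
  have hε' : 0 < 1 - ε := by linarith
  have h0 : 0 ≤ p.toReal := ENNReal.toReal_nonneg
  rw [← ENNReal.ofReal_toReal hp', ← ENNReal.ofReal_toReal hq',
    ← ENNReal.ofReal_mul (div_nonneg (h0.trans hp) hε'.le)]
  refine ENNReal.ofReal_le_ofReal ?_
  rw [div_mul_eq_mul_div, le_div_iff₀ hε']
  nlinarith

lemma ofReal_div_mul_le_of_le_toReal {p q : ℝ≥0∞} (hpq : p + q = 1) {ε : ℝ} (hε0 : 0 ≤ ε)
    (hε : ε < 1) (hp : ε ≤ p.toReal) : ENNReal.ofReal (ε / (1 - ε)) * q ≤ p := by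
  have hp' : p ≠ ⊤ := ne_top_of_le_ne_top ENNReal.one_ne_top (hpq ▸ le_self_add)
  have hq' : q ≠ ⊤ := ne_top_of_le_ne_top ENNReal.one_ne_top (hpq ▸ le_add_self)
  have hsum : p.toReal + q.toReal = 1 := by rw [← ENNReal.toReal_add hp' hq', hpq]; rfl
  have hε' : 0 < 1 - ε := by linarith
  rw [← ENNReal.ofReal_toReal hp', ← ENNReal.ofReal_toReal hq',
    ← ENNReal.ofReal_mul (div_nonneg hε0 hε'.le)]
  refine ENNReal.ofReal_le_ofReal ?_
  rw [div_mul_eq_mul_div, div_le_iff₀ hε']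
  nlinarith

/-- The test converges almost surely to the density of `f` with respect to `f + g`. -/
def ConvergesToDensity (T : Test) : Prop :=
  ∀ f g : Measure BinSeq, IsProbabilityMeasure f → IsProbabilityMeasure g →
    ∀ᵐ ω ∂(f + g), Tendsto (fun t => T f g t ω) atTop (nhds (f.rnDeriv (f + g) ω).toReal)

lemma LSet_eq_RSet_swap {T : Test} (hT : Anonymous T) {f g : Measure BinSeq}
    (hf : IsProbabilityMeasure f) (hg : IsProbabilityMeasure g) (ε : ℝ) :
    LSet T f g ε = RSet T g f (1 - ε) := by
  ext ω
  constructor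
  · rintro ⟨l, hl, hε⟩
    refine ⟨1 - l, (hl.const_sub 1).congr' ?_, by linarith⟩
    filter_upwards [eventually_ge_atTop 1] with t ht using (hT g f hg hf t ht ω).symm
  · rintro ⟨l, hl, hε⟩
    refine ⟨1 - l, (hl.const_sub 1).congr' ?_, by linarith⟩
    filter_upwards [eventually_ge_atTop 1] with t ht using (hT f g hf hg t ht ω).symm

namespace ConvergesToDensity

lemma measure_inter_RSet_le {T : Test} (hT : ConvergesToDensity T) {f g : Measure BinSeq}
    (hf : IsProbabilityMeasure f) (hg : IsProbabilityMeasure g)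
    (A : Set BinSeq) {ε : ℝ} (hε : ε < 1) :
    f (A ∩ RSet T f g ε) ≤ ENNReal.ofReal (ε / (1 - ε)) * g (A ∩ RSet T f g ε) := by
  have hfa : f ≪ f + g := Measure.absolutelyContinuous_of_le (Measure.le_add_right le_rfl)
  have hga : g ≪ f + g := Measure.absolutelyContinuous_of_le (Measure.le_add_left le_rfl)
  rw [← one_mul (f _)]
  refine measure_le_mul_of_ae_rnDeriv_le hfa hga ?_
  filter_upwards [hT f g hf hg, ae_rnDeriv_add_eq_one f g] with ω h1 h2
  rintro ⟨-, l, hl, hlε⟩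
  rw [one_mul]
  exact le_ofReal_div_mul_of_toReal_le h2 hε (tendsto_nhds_unique h1 hl ▸ hlε.le)

lemma measure_inter_RSet_pos {T : Test} (hT : ConvergesToDensity T) {f g : Measure BinSeq}
    (hf : IsProbabilityMeasure f) (hg : IsProbabilityMeasure g)
    {A : Set BinSeq} {ε : ℝ} (hε0 : 0 ≤ ε) (hε : ε < 1)
    (h : f A < ENNReal.ofReal (ε / (1 - ε)) * g A) : 0 < g (A ∩ RSet T f g ε) := by
  by_contra hzero
  rw [not_lt, nonpos_iff_eq_zero] at hzero
  have hfa : f ≪ f + g := Measure.absolutelyContinuous_of_le (Measure.le_add_right le_rfl)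
  have hga : g ≪ f + g := Measure.absolutelyContinuous_of_le (Measure.le_add_left le_rfl)
  have hdiff : ENNReal.ofReal (ε / (1 - ε)) * g (A \ RSet T f g ε) ≤
      1 * f (A \ RSet T f g ε) := by
    refine measure_le_mul_of_ae_rnDeriv_le hga hfa ?_
    filter_upwards [hT f g hf hg, ae_rnDeriv_add_eq_one f g] with ω h1 h2
    rintro ⟨-, hω⟩
    rw [one_mul]
    refine ofReal_div_mul_le_of_le_toReal h2 hε0 hε (not_lt.1 fun hlt => hω ⟨_, h1, hlt⟩)
  have hA : g A ≤ g (A \ RSet T f g ε) := by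
    simpa [hzero] using measure_le_inter_add_sdiff g A (RSet T f g ε)
  refine h.not_ge (le_trans (by gcongr) (hdiff.trans ?_))
  rw [one_mul]
  exact measure_mono Set.sdiff_subset

lemma errorFree {T : Test} (hT : ConvergesToDensity T)
    (hanon : Anonymous T) : ErrorFree T := by
  intro f g hf hg A _
  refine ⟨fun ε hε => hT.measure_inter_RSet_le hf hg A (by linarith [hε.2]), fun ε hε => ?_⟩
  rw [LSet_eq_RSet_swap hanon hf hg]
  simpa using hT.measure_inter_RSet_le hg hf A (ε := 1 - ε) (by linarith [hε.1])

lemma reasonable {T : Test} (hT : ConvergesToDensity T)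
    (hanon : Anonymous T) : Reasonable T := by
  intro f g hf hg A _
  refine ⟨fun ε hε _ h => hT.measure_inter_RSet_pos hf hg hε.1.le (by linarith [hε.2]) h,
    fun ε hε _ h => ?_⟩
  rw [LSet_eq_RSet_swap hanon hf hg]
  exact hT.measure_inter_RSet_pos hg hf (by linarith [hε.2]) (by linarith [hε.1]) (by simpa using h)

end ConvergesToDensity

lemma eventually_notMem_cyl {ω ω' : BinSeq} (h : ω' ≠ ω) : ∀ᶠ t in atTop, ω' ∉ cyl ω t := by
  obtain ⟨i, hi⟩ := Function.ne_iff.1 h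
  filter_upwards [eventually_gt_atTop i] with t ht hmem using hi (hmem i ht)

lemma tendsto_one_div_one_add_mul_two_pow {c : ℝ} (hc : 0 < c) :
    Tendsto (fun t : ℕ => 1 / (1 + c * (2 : ℝ) ^ t)) atTop (nhds 0) := by
  simp_rw [one_div]
  exact (tendsto_atTop_add_const_left _ _
    ((tendsto_pow_atTop_atTop_of_one_lt one_lt_two).const_mul_atTop hc)).inv_tendsto_atTop

/-- The modified finite derivative test (slowed down by a factor `c > 1` along the all-ones
play path of the fair-coin forecaster versus the point mass at the all-ones sequence) is an
anonymous, error-free and reasonable cardinal comparison test, and differs from `D`. -/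
theorem stmt5 (c : ℝ) (hc : 1 < c)
    (ftilde : Measure BinSeq) (hfprob : IsProbabilityMeasure ftilde)
    (hfcyl : ∀ (ω : BinSeq) (t : ℕ), ftilde (cyl ω t) = (1/2 : ℝ≥0∞) ^ t)
    (gtilde : Measure BinSeq) (hgdef : gtilde = Measure.dirac ones)
    (T : Test)
    (hT1 : ∀ (t : ℕ) (ω : BinSeq), ω ∈ cyl ones t →
      T ftilde gtilde (t+1) ω =
        1 / (1 + c * ((gtilde (cyl ω t)).toReal / (ftilde (cyl ω t)).toReal)))
    (hT2 : ∀ (t : ℕ) (ω : BinSeq), ω ∈ cyl ones t →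
      T gtilde ftilde (t+1) ω =
        1 - 1 / (1 + c * ((gtilde (cyl ω t)).toReal / (ftilde (cyl ω t)).toReal)))
    (hT3 : ∀ (f g : Measure BinSeq) (t : ℕ) (ω : BinSeq),
      (¬ ((f = ftilde ∧ g = gtilde) ∨ (f = gtilde ∧ g = ftilde)) ∨ ω ∉ cyl ones t) →
      T f g (t+1) ω = Dtest f g (t+1) ω) :
    IsCCTest T ∧ Anonymous T ∧ ErrorFree T ∧ Reasonable T ∧ T ≠ Dtest := by
  have hc0 : 0 < c := one_pos.trans hc
  have hgprob : IsProbabilityMeasure gtilde := by rw [hgdef]; infer_instance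
  have hgcyl : ∀ (ω : BinSeq) (t : ℕ), ω ∈ cyl ones t → gtilde (cyl ω t) = 1 := by
    intro ω t h
    rw [hgdef]
    exact Measure.dirac_apply_of_mem (mem_cyl_comm.1 h)
  have hT1' : ∀ (t : ℕ) (ω : BinSeq), ω ∈ cyl ones t →
      T ftilde gtilde (t+1) ω = 1 / (1 + c * 2 ^ t) := by
    intro t ω h
    rw [hT1 t ω h, hgcyl ω t h, hfcyl]
    simp
  have hT2' : ∀ (t : ℕ) (ω : BinSeq), ω ∈ cyl ones t →
      T gtilde ftilde (t+1) ω = 1 - 1 / (1 + c * 2 ^ t) := by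
    intro t ω h
    rw [hT2 t ω h, hgcyl ω t h, hfcyl]
    simp
  have hD1 : ∀ (t : ℕ) (ω : BinSeq), ω ∈ cyl ones t →
      Dtest ftilde gtilde (t+1) ω = 1 / (1 + 1 * 2 ^ t) := by
    intro t ω h
    simp only [Dtest, hgcyl ω t h, hfcyl]
    rw [if_pos (by simp)]
    simp only [one_div, inv_pow, ENNReal.toReal_inv, ENNReal.toReal_pow, ENNReal.toReal_ofNat,
      ENNReal.toReal_one]
    field_simp
  have hanon : Anonymous T := by
    intro f g hf hg t ht ω
    obtain ⟨s, rfl⟩ := Nat.exists_eq_add_of_le' ht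
    by_cases hω : ω ∈ cyl ones s
    · by_cases h1 : f = ftilde ∧ g = gtilde
      · obtain ⟨rfl, rfl⟩ := h1
        rw [hT1' s ω hω, hT2' s ω hω]
        ring
      by_cases h2 : f = gtilde ∧ g = ftilde
      · obtain ⟨rfl, rfl⟩ := h2
        rw [hT1' s ω hω, hT2' s ω hω]
      rw [hT3 f g s ω (Or.inl (by tauto)), hT3 g f s ω (Or.inl (by tauto)), Dtest_swap]
    · rw [hT3 f g s ω (Or.inr hω), hT3 g f s ω (Or.inr hω), Dtest_swap]
  have hpow : ∀ s : ℕ, 1 / (1 + c * 2 ^ s) ∈ Set.Icc (0 : ℝ) 1 := fun s =>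
    ⟨by positivity, div_le_one_of_le₀ (le_add_of_nonneg_right (by positivity)) (by positivity)⟩
  have hcc : IsCCTest T := by
    intro f g hf hg t ht
    obtain ⟨s, rfl⟩ := Nat.exists_eq_add_of_le' ht
    refine ⟨fun ω => ?_, (measurable_coordAlg_of_cyl (s := s) fun ω ω' h => ?_).mono
      (coordAlg_mono s.le_succ) le_rfl⟩
    · by_cases hω : ¬ ((f = ftilde ∧ g = gtilde) ∨ (f = gtilde ∧ g = ftilde)) ∨ ω ∉ cyl ones s
      · rw [hT3 f g s ω hω]
        exact Dtest_mem_Icc f g s ω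
      · rw [not_or, not_not, not_not] at hω
        rcases hω with ⟨⟨rfl, rfl⟩ | ⟨rfl, rfl⟩, hω⟩
        · rw [hT1' s ω hω]
          exact hpow s
        · rw [hT2' s ω hω]
          exact ⟨by linarith [(hpow s).2], by linarith [(hpow s).1]⟩
    · have hiff : ω' ∈ cyl ones s ↔ ω ∈ cyl ones s := by
        rw [mem_cyl_comm, cyl_eq_of_mem h, mem_cyl_comm]
      by_cases hω : ¬ ((f = ftilde ∧ g = gtilde) ∨ (f = gtilde ∧ g = ftilde)) ∨ ω ∉ cyl ones s
      · rw [hT3 f g s ω hω, hT3 f g s ω' (by rwa [hiff]), Dtest_eq_of_mem_cyl f g h]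
      · rw [not_or, not_not, not_not] at hω
        rcases hω with ⟨⟨rfl, rfl⟩ | ⟨rfl, rfl⟩, hω⟩
        · rw [hT1' s ω hω, hT1' s ω' (hiff.2 hω)]
        · rw [hT2' s ω hω, hT2' s ω' (hiff.2 hω)]
  have hdiff1 : ∀ ω, Tendsto (fun t => T ftilde gtilde (t+1) ω - Dtest ftilde gtilde (t+1) ω)
      atTop (nhds 0) := by
    intro ω
    by_cases hω : ω = ones
    · subst hω
      simp_rw [fun t => hT1' t ones (mem_cyl_self _ _), fun t => hD1 t ones (mem_cyl_self _ _)]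
      simpa using (tendsto_one_div_one_add_mul_two_pow hc0).sub
        (tendsto_one_div_one_add_mul_two_pow one_pos)
    · refine tendsto_const_nhds.congr' ?_
      filter_upwards [eventually_notMem_cyl hω] with t ht
      rw [hT3 _ _ t ω (Or.inr ht), sub_self]
  have hdiff : ∀ f g : Measure BinSeq, ∀ ω,
      Tendsto (fun t => T f g (t+1) ω - Dtest f g (t+1) ω) atTop (nhds 0) := by
    intro f g ω
    by_cases hfg : (f = ftilde ∧ g = gtilde) ∨ (f = gtilde ∧ g = ftilde)
    · rcases hfg with ⟨rfl, rfl⟩ | ⟨rfl, rfl⟩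
      · exact hdiff1 ω
      · have h := (hdiff1 ω).neg
        rw [neg_zero] at h
        refine h.congr fun t => ?_
        rw [hanon f g hgprob hfprob (t + 1) (by lia) ω, Dtest_swap f g]
        ring
    · simp_rw [fun t => hT3 f g t ω (Or.inl hfg), sub_self]
      exact tendsto_const_nhds
  have hconv : ConvergesToDensity T := by
    intro f g hf hg
    filter_upwards [ae_tendsto_Dtest f g] with ω h
    refine (tendsto_add_atTop_iff_nat 1).1 ?_
    simpa using (hdiff f g ω).add ((tendsto_add_atTop_iff_nat 1).2 h)
  refine ⟨hcc, hanon, hconv.errorFree hanon, hconv.reasonable hanon, fun hTD => ?_⟩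
  have h1 := hT1' 0 ones (mem_cyl_self _ _)
  rw [hTD, hD1 0 ones (mem_cyl_self _ _)] at h1
  field_simp at h1
  norm_num at h1
  linarith
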